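/- For an L-smooth function f bounded below by f*, SGD with constant step size η_t = η/√T (with L·η ≤ √T) using unbiased stochastic gradients g_t with E[g_t|θ_t] = ∇f(θ_t) and E‖g_t‖² ≤ G² + σ² satisfies (1/T)∑_{t=1}^T E‖∇f(θ_t)‖² ≤ 2(f(θ_0) − f*)/(η√T) + L·η·(G² + σ²)/√T. -/

import Mathlib

open MeasureTheory RealInnerProductSpace

section Smooth

variable {E : Type*} [NormedAddCommGroup E] [InnerProductSpace ℝ E]
  {Ω : Type*} {m mΩ : MeasurableSpace Ω} {μ : Measure Ω}

theorem integrable_inner_of_memLp_two {X Y : Ω → E} (hX : MemLp X 2 μ) (hY : MemLp Y 2 μ) :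
    Integrable (fun ω ↦ ⟪X ω, Y ω⟫) μ := by
  refine ((hX.integrable_norm_pow (p := 2) two_ne_zero).add
    (hY.integrable_norm_pow (p := 2) two_ne_zero)).mono' (hX.1.inner hY.1)
    (ae_of_all _ fun ω ↦ (norm_inner_le_norm _ _).trans ?_)
  simp only [Pi.add_apply]
  nlinarith [sq_nonneg (‖X ω‖ - ‖Y ω‖), sq_nonneg (‖X ω‖ + ‖Y ω‖)]

variable [CompleteSpace E] {f : E → ℝ} {L : ℝ}

/-- The descent lemma: an `L`-smooth function lies below its quadratic upper model. -/
theorem le_quadratic_of_gradient_lipschitz (hdiff : Differentiable ℝ f)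
    (hsmooth : ∀ x y, ‖gradient f x - gradient f y‖ ≤ L * ‖x - y‖) (x v : E) :
    f (x + v) ≤ f x + ⟪gradient f x, v⟫ + L / 2 * ‖v‖ ^ 2 := by
  let φ : ℝ → ℝ := fun s ↦ f (x + s • v) - s * ⟪gradient f x, v⟫ - L / 2 * ‖v‖ ^ 2 * s ^ 2
  have hφ (s : ℝ) : HasDerivAt φ
      (⟪gradient f (x + s • v), v⟫ - ⟪gradient f x, v⟫ - L * ‖v‖ ^ 2 * s) s := by
    have hline : HasDerivAt (fun s : ℝ ↦ x + s • v) v s := by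
      simpa using ((hasDerivAt_id s).smul_const v).const_add x
    have hf : HasDerivAt (fun s : ℝ ↦ f (x + s • v)) ⟪gradient f (x + s • v), v⟫ s := by
      simpa [Function.comp_def] using
        (hdiff (x + s • v)).hasGradientAt.hasFDerivAt.comp_hasDerivAt s hline
    refine ((hf.sub ((hasDerivAt_id s).mul_const ⟪gradient f x, v⟫)).sub
      ((hasDerivAt_pow 2 s).const_mul (L / 2 * ‖v‖ ^ 2))).congr_deriv ?_
    norm_num
    ring
  have hanti : AntitoneOn φ (Set.Icc 0 1) := by
    refine antitoneOn_of_deriv_nonpos (convex_Icc 0 1)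
      (fun s _ ↦ (hφ s).continuousAt.continuousWithinAt)
      (fun s _ ↦ (hφ s).differentiableAt.differentiableWithinAt) fun s hs ↦ ?_
    rw [interior_Icc] at hs
    rw [(hφ s).deriv, ← inner_sub_left]
    have h := hsmooth (x + s • v) x
    rw [add_sub_cancel_left, norm_smul, Real.norm_of_nonneg hs.1.le] at h
    have h' := (real_inner_le_norm (gradient f (x + s • v) - gradient f x) v).trans
      (mul_le_mul_of_nonneg_right h (norm_nonneg v))
    linarith
  have h := hanti (Set.left_mem_Icc.2 zero_le_one) (Set.right_mem_Icc.2 zero_le_one) zero_le_one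
  simp only [φ, one_smul, zero_smul, add_zero] at h
  linarith

theorem continuous_gradient_of_lipschitz
    (hsmooth : ∀ x y, ‖gradient f x - gradient f y‖ ≤ L * ‖x - y‖) :
    Continuous (gradient f) :=
  (LipschitzWith.of_dist_le_mul (K := L.toNNReal) fun x y ↦ by
    simpa [dist_eq_norm] using (hsmooth x y).trans
      (mul_le_mul_of_nonneg_right (le_max_left L 0) (norm_nonneg _))).continuous

theorem MeasureTheory.MemLp.gradient_comp [IsFiniteMeasure μ] {X : Ω → E}
    (hsmooth : ∀ x y, ‖gradient f x - gradient f y‖ ≤ L * ‖x - y‖) (hX : MemLp X 2 μ) :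
    MemLp (fun ω ↦ gradient f (X ω)) 2 μ := by
  refine ((memLp_const ‖gradient f 0‖).add (hX.norm.const_mul L)).mono'
    ((continuous_gradient_of_lipschitz hsmooth).comp_aestronglyMeasurable hX.1)
    (ae_of_all _ fun ω ↦ ?_)
  have h := hsmooth (X ω) 0
  rw [sub_zero] at h
  have h' := norm_le_norm_add_norm_sub' (gradient f (X ω)) (gradient f 0)
  simpa using h'.trans (by linarith)

theorem integrable_comp_of_gradient_lipschitz [IsFiniteMeasure μ] {X : Ω → E} {c : ℝ}
    (hdiff : Differentiable ℝ f)
    (hsmooth : ∀ x y, ‖gradient f x - gradient f y‖ ≤ L * ‖x - y‖)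
    (hbelow : ∀ x, c ≤ f x) (hX : MemLp X 2 μ) :
    Integrable (fun ω ↦ f (X ω)) μ := by
  have hupper : Integrable
      (fun ω ↦ f 0 + ⟪gradient f 0, X ω⟫ + L / 2 * ‖X ω‖ ^ 2) μ :=
    ((integrable_const _).add (integrable_inner_of_memLp_two (memLp_const _) hX)).add
      ((hX.integrable_norm_pow (p := 2) two_ne_zero).const_mul _)
  refine integrable_of_le_of_le (hdiff.continuous.comp_aestronglyMeasurable hX.1)
    (ae_of_all _ fun ω ↦ hbelow (X ω)) (ae_of_all _ fun ω ↦ ?_) (integrable_const c) hupper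
  simpa using le_quadratic_of_gradient_lipschitz hdiff hsmooth 0 (X ω)

/-- If `Z` is an unbiased estimate of the `m`-measurable `Y`, then `E⟪Y, Z⟫ = E‖Y‖²`. -/
theorem integral_inner_eq_of_condExp_eq [IsFiniteMeasure μ]
    (hm : m ≤ mΩ) {Y Z : Ω → E} (hYm : StronglyMeasurable[m] Y)
    (hY : MemLp Y 2 μ) (hZ : MemLp Z 2 μ) (hcond : μ[Z | m] =ᵐ[μ] Y) :
    ∫ ω, ⟪Y ω, Z ω⟫ ∂μ = ∫ ω, ‖Y ω‖ ^ 2 ∂μ := by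
  have hpull : μ[fun ω ↦ ⟪Y ω, Z ω⟫ | m] =ᵐ[μ] fun ω ↦ ⟪Y ω, μ[Z | m] ω⟫ := by
    exact condExp_bilin_of_stronglyMeasurable_left (innerSL ℝ) hYm
      (integrable_inner_of_memLp_two hY hZ) (hZ.integrable one_le_two)
  rw [← integral_condExp hm]
  refine integral_congr_ae ?_
  filter_upwards [hpull, hcond] with ω h₁ h₂
  rw [h₁, h₂, real_inner_self_eq_norm_sq]

/-- Expected decrease of an `L`-smooth function in one stochastic gradient step. -/
theorem integral_comp_sgd_step_le [IsProbabilityMeasure μ]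
    (hm : m ≤ mΩ) {X Z : Ω → E} {c α M : ℝ} (hL : 0 ≤ L)
    (hdiff : Differentiable ℝ f)
    (hsmooth : ∀ x y, ‖gradient f x - gradient f y‖ ≤ L * ‖x - y‖)
    (hbelow : ∀ x, c ≤ f x) (hXm : StronglyMeasurable[m] X)
    (hX : MemLp X 2 μ) (hZ : MemLp Z 2 μ)
    (hcond : μ[Z | m] =ᵐ[μ] fun ω ↦ gradient f (X ω))
    (hmoment : ∫ ω, ‖Z ω‖ ^ 2 ∂μ ≤ M) :
    ∫ ω, f (X ω - α • Z ω) ∂μ ≤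
      ∫ ω, f (X ω) ∂μ - α * ∫ ω, ‖gradient f (X ω)‖ ^ 2 ∂μ + L / 2 * α ^ 2 * M := by
  have hgrad := hX.gradient_comp hsmooth
  have hfX := integrable_comp_of_gradient_lipschitz hdiff hsmooth hbelow hX
  have hfX' := integrable_comp_of_gradient_lipschitz hdiff hsmooth hbelow
    (hX.sub (hZ.const_smul α))
  have hinner := (integrable_inner_of_memLp_two hgrad hZ).const_mul α
  have hsq := (hZ.integrable_norm_pow (p := 2) two_ne_zero).const_mul (L / 2 * α ^ 2)
  calc ∫ ω, f (X ω - α • Z ω) ∂μ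
      ≤ ∫ ω, (f (X ω) - α * ⟪gradient f (X ω), Z ω⟫ + L / 2 * α ^ 2 * ‖Z ω‖ ^ 2) ∂μ := by
        refine integral_mono hfX' ((hfX.sub hinner).add hsq) fun ω ↦ ?_
        have h := le_quadratic_of_gradient_lipschitz hdiff hsmooth (X ω) (-(α • Z ω))
        rw [← sub_eq_add_neg, inner_neg_right, real_inner_smul_right, norm_neg, norm_smul,
          mul_pow, Real.norm_eq_abs, sq_abs] at h
        linarith
    _ = ∫ ω, f (X ω) ∂μ - α * ∫ ω, ‖gradient f (X ω)‖ ^ 2 ∂μ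
          + L / 2 * α ^ 2 * ∫ ω, ‖Z ω‖ ^ 2 ∂μ := by
        rw [integral_add (by exact hfX.sub hinner) hsq, integral_sub hfX hinner, integral_const_mul,
          integral_const_mul, integral_inner_eq_of_condExp_eq hm
            ((continuous_gradient_of_lipschitz hsmooth).comp_stronglyMeasurable hXm)
            hgrad hZ hcond]
    _ ≤ _ := by gcongr

end Smooth

/-- SGD on an `L`-smooth function bounded below, with constant step size `η/√T`,
unbiased stochastic gradients (conditionally on the current iterate) and second
moment bounded by `G² + σ²`, satisfies the standard `O(1/√T)` bound on the
average expected squared gradient norm. -/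
theorem sgd_convergence
    {d : ℕ} {Ω : Type*} [MeasurableSpace Ω] (μ : Measure Ω) [IsProbabilityMeasure μ]
    (f : EuclideanSpace ℝ (Fin d) → ℝ) (fstar : ℝ) (L G σ η : ℝ) (T : ℕ)
    (θ g : ℕ → Ω → EuclideanSpace ℝ (Fin d)) (x0 : EuclideanSpace ℝ (Fin d))
    (hL : 0 < L) (hη : 0 < η) (hT : 0 < T)
    (hstep : L * η ≤ Real.sqrt T)
    (hdiff : Differentiable ℝ f)
    (hsmooth : ∀ x y, ‖gradient f x - gradient f y‖ ≤ L * ‖x - y‖)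
    (hbelow : ∀ x, fstar ≤ f x)
    (hinit : ∀ ω, θ 0 ω = x0)
    (hiter : ∀ t ω, θ (t + 1) ω = θ t ω - (η / Real.sqrt T) • g t ω)
    (hmeas : ∀ t, Measurable (θ t))
    (hint : ∀ t, Integrable (g t) μ)
    (hunbiased : ∀ t,
      μ[g t | MeasurableSpace.comap (θ t) (by infer_instance)]
        =ᵐ[μ] fun ω => gradient f (θ t ω))
    (hmoment : ∀ t, ∫ ω, ‖g t ω‖ ^ 2 ∂μ ≤ G ^ 2 + σ ^ 2)
    (hint2 : ∀ t, Integrable (fun ω => ‖g t ω‖ ^ 2) μ) :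
    (1 / (T : ℝ)) * ∑ t ∈ Finset.Icc 1 T, ∫ ω, ‖gradient f (θ t ω)‖ ^ 2 ∂μ
      ≤ 2 * (f x0 - fstar) / (η * Real.sqrt T)
        + L * η * (G ^ 2 + σ ^ 2) / Real.sqrt T := by
  set α := η / Real.sqrt T with hα
  set M := G ^ 2 + σ ^ 2
  have hT' : (1 : ℝ) ≤ T := by exact_mod_cast hT
  have hs : 0 < Real.sqrt T := Real.sqrt_pos.2 (by linarith)
  have hα0 : 0 < α := div_pos hη hs
  have hM0 : 0 ≤ M := by positivity
  have hg2 (t : ℕ) : MemLp (g t) 2 μ := (memLp_two_iff_integrable_sq_norm (hint t).1).2 (hint2 t)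
  have hθ2 (t : ℕ) : MemLp (θ t) 2 μ := by
    induction t with
    | zero => rw [funext hinit]; exact memLp_const x0
    | succ t ih => rw [funext (hiter t)]; exact ih.sub ((hg2 t).const_smul α)
  have hstep_le (t : ℕ) : ∫ ω, f (θ (t + 1) ω) ∂μ ≤ ∫ ω, f (θ t ω) ∂μ
      - α * ∫ ω, ‖gradient f (θ t ω)‖ ^ 2 ∂μ + L / 2 * α ^ 2 * M := by
    simp only [hiter]
    exact integral_comp_sgd_step_le (hmeas t).comap_le hL.le hdiff hsmooth hbelow
      (comap_measurable (θ t)).stronglyMeasurable (hθ2 t) (hg2 t) (hunbiased t) (hmoment t)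
  have hsum (n : ℕ) : α * ∑ t ∈ Finset.Icc 1 n, ∫ ω, ‖gradient f (θ t ω)‖ ^ 2 ∂μ
      ≤ f x0 - ∫ ω, f (θ (n + 1) ω) ∂μ + (n + 1) * (L / 2 * α ^ 2 * M) := by
    induction n with
    | zero =>
      have h := hstep_le 0
      have h0 : ∫ ω, f (θ 0 ω) ∂μ = f x0 := by simp [hinit]
      have hnonneg : 0 ≤ α * ∫ ω, ‖gradient f (θ 0 ω)‖ ^ 2 ∂μ := by positivity
      simp only [zero_add, Nat.cast_zero, Finset.Icc_eq_empty_of_lt zero_lt_one,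
        Finset.sum_empty, mul_zero] at h ⊢
      linarith
    | succ n ih =>
      have h := hstep_le (n + 1)
      rw [Finset.sum_Icc_succ_top (by omega), mul_add]
      push_cast
      linarith
  have hlower : fstar ≤ ∫ ω, f (θ (T + 1) ω) ∂μ := by
    simpa using integral_mono (integrable_const fstar)
      (integrable_comp_of_gradient_lipschitz hdiff hsmooth hbelow (hθ2 (T + 1)))
      fun ω ↦ hbelow (θ (T + 1) ω)
  have hcount : (T + 1) * (L / 2 * α ^ 2 * M) ≤ T * (L * α ^ 2 * M) := by
    have : 0 ≤ L * α ^ 2 * M := by positivity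
    nlinarith
  have hbound := hsum T
  have hgap := hbelow x0
  have hsq : Real.sqrt T * Real.sqrt T = T := Real.mul_self_sqrt (by linarith)
  have hrhs : 2 * (f x0 - fstar) / (η * Real.sqrt T) + L * η * M / Real.sqrt T
      = (2 * (f x0 - fstar) + T * (L * α ^ 2 * M)) / (α * T) := by
    clear_value α
    generalize Real.sqrt (T : ℝ) = s at hα hs hsq ⊢
    rw [hα, ← hsq]
    field_simp
  rw [hrhs, le_div_iff₀ (by positivity)]
  calc _ = α * ∑ t ∈ Finset.Icc 1 T, ∫ ω, ‖gradient f (θ t ω)‖ ^ 2 ∂μ := by field_simp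
    _ ≤ _ := by linarith
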